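/- The function G is continuously differentiable on ℝ and its derivative satisfies 1 − 6c·max_{1≤j≤k}|α_j| ≤ G'(x) ≤ 1 + 6c·max_{1≤j≤k}|α_j| for every x ∈ ℝ; in particular G'(x) > 0 for all x ∈ ℝ. -/

import Mathlib

open Filter Set

/-- The bump function `φ(u) = (1+u)³(1−u)³` for `|u| ≤ 1` and `φ(u) = 0` otherwise. -/
noncomputable def phi (u : ℝ) : ℝ := if |u| ≤ 1 then (1 + u) ^ 3 * (1 - u) ^ 3 else 0

/-- The transformation `G(x) = x + Σ_{j=1}^k α_j φ((x−ζ_j)/c)(x−ζ_j)|x−ζ_j|`. -/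
noncomputable def Gfun (k : ℕ) (ζ α : Fin k → ℝ) (c : ℝ) (x : ℝ) : ℝ :=
  x + ∑ j : Fin k, α j * (phi ((x - ζ j) / c) * ((x - ζ j) * |x - ζ j|))

theorem hasDerivAt_mul_abs_self (t : ℝ) : HasDerivAt (fun t : ℝ => t * |t|) (2 * |t|) t := by
  rcases eq_or_ne t 0 with rfl | ht
  · rw [hasDerivAt_iff_tendsto_slope_zero]
    have h : Tendsto (fun t : ℝ => |t|) (nhdsWithin 0 {0}ᶜ) (nhds (2 * |(0 : ℝ)|)) := by
      have := (continuous_abs (G := ℝ)).tendsto 0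
      simp only [abs_zero, mul_zero] at this ⊢
      exact this.mono_left nhdsWithin_le_nhds
    refine h.congr' ?_
    filter_upwards [self_mem_nhdsWithin] with t ht
    have ht : t ≠ 0 := ht
    simp [ht]
  · refine ((hasDerivAt_id' t).fun_mul (hasDerivAt_abs ht)).congr_deriv ?_
    rcases lt_or_gt_of_ne ht with h | h
    · simp [h, abs_of_neg h]; ring
    · simp [h, abs_of_pos h]; ring

/-- A formula for `phi` without case distinction: `max s 0 ^ 3 = (s³ + s²|s|) / 2` at `s = 1 - u²`. -/
theorem phi_eq (u : ℝ) :
    phi u = ((1 - u ^ 2) ^ 3 + (1 - u ^ 2) * ((1 - u ^ 2) * |1 - u ^ 2|)) / 2 := by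
  unfold phi
  split_ifs with h
  · rw [abs_of_nonneg (sub_nonneg.2 ((sq_le_one_iff_abs_le_one u).2 h))]
    ring
  · rw [abs_of_neg (sub_neg.2 (not_le.1 (mt (sq_le_one_iff_abs_le_one u).1 h)))]
    ring

/-- The derivative of `u ↦ phi u * (u * |u|)`. -/
noncomputable def phiMulDeriv (u : ℝ) : ℝ :=
  |u| * ((1 - u ^ 2) ^ 2 + (1 - u ^ 2) * |1 - u ^ 2|) * (1 - 4 * u ^ 2)

theorem continuous_phiMulDeriv : Continuous phiMulDeriv := by
  unfold phiMulDeriv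
  fun_prop

theorem hasDerivAt_phi_mul (u : ℝ) :
    HasDerivAt (fun u => phi u * (u * |u|)) (phiMulDeriv u) u := by
  have hs : HasDerivAt (fun u : ℝ => 1 - u ^ 2) (-(2 * u)) u := by
    simpa using ((hasDerivAt_id u).pow 2).const_sub 1
  have habs : HasDerivAt (fun u : ℝ => (1 - u ^ 2) * |1 - u ^ 2|)
      (2 * |1 - u ^ 2| * -(2 * u)) u := HasDerivAt.comp (h₂ := fun t : ℝ => t * |t|) u
        (hasDerivAt_mul_abs_self (1 - u ^ 2)) hs
  have hphi := ((hs.pow 3).add (hs.mul habs)).div_const 2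
  have h := hphi.mul (hasDerivAt_mul_abs_self u)
  refine (h.congr_deriv ?_).congr_of_eventuallyEq (Eventually.of_forall fun v => ?_)
  · simp only [phiMulDeriv, Pi.add_apply, Pi.mul_apply, Pi.pow_apply]
    push_cast
    ring
  · simp only [phi_eq, Pi.add_apply, Pi.mul_apply, Pi.pow_apply]

theorem phiMulDeriv_eq_zero {u : ℝ} (hu : 1 ≤ |u|) : phiMulDeriv u = 0 := by
  have h : 1 - u ^ 2 ≤ 0 := sub_nonpos.2 ((one_le_sq_iff_one_le_abs u).2 hu)
  rw [phiMulDeriv, abs_of_nonpos h]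
  ring

theorem abs_phiMulDeriv_le (u : ℝ) : |phiMulDeriv u| ≤ 6 := by
  rcases le_total 1 |u| with h | h
  · simp [phiMulDeriv_eq_zero h]
  have hu : u ^ 2 ≤ 1 := (sq_le_one_iff_abs_le_one u).2 h
  have h0 := sq_nonneg u
  rw [phiMulDeriv, abs_of_nonneg (sub_nonneg.2 hu), abs_mul, abs_mul, abs_abs]
  have h1 : |(1 - u ^ 2) ^ 2 + (1 - u ^ 2) * (1 - u ^ 2)| ≤ 2 :=
    abs_le.2 ⟨by nlinarith, by nlinarith⟩
  have h2 : |1 - 4 * u ^ 2| ≤ 3 := abs_le.2 ⟨by linarith, by linarith⟩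
  calc _ ≤ (1 : ℝ) * 2 * 3 := by gcongr
    _ = 6 := by norm_num

theorem hasDerivAt_Gfun {k : ℕ} (ζ α : Fin k → ℝ) {c : ℝ} (hc : 0 < c) (x : ℝ) :
    HasDerivAt (Gfun k ζ α c) (1 + ∑ j, α j * (c * phiMulDeriv ((x - ζ j) / c))) x := by
  refine (hasDerivAt_id x).add (HasDerivAt.fun_sum fun j _ => HasDerivAt.const_mul _ ?_)
  have hu : HasDerivAt (fun x => (x - ζ j) / c) (1 / c) x :=
    ((hasDerivAt_id x).sub_const (ζ j)).div_const c
  have h := ((hasDerivAt_phi_mul ((x - ζ j) / c)).comp x hu).const_mul (c ^ 2)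
  refine (h.congr_deriv ?_).congr_of_eventuallyEq (Eventually.of_forall fun y => ?_)
  · field_simp
  · simp only [Function.comp_apply, abs_div, abs_of_pos hc]
    field_simp

/-- The supports of the summands are disjoint, so the derivative of the perturbation is controlled
by a single coefficient. -/
theorem sum_phiMulDeriv_eq_zero_or_abs_le {k : ℕ} {ζ : Fin k → ℝ} (α : Fin k → ℝ) {c : ℝ}
    (hc : 0 < c) (hζ : ∀ i j, i < j → 2 * c < ζ j - ζ i) (x : ℝ) :
    ∑ j, α j * (c * phiMulDeriv ((x - ζ j) / c)) = 0 ∨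
      ∃ j, α j ≠ 0 ∧ |∑ j, α j * (c * phiMulDeriv ((x - ζ j) / c))| ≤ 6 * c * |α j| := by
  rw [or_iff_not_imp_left]
  intro hne
  obtain ⟨j, -, hj⟩ := Finset.exists_ne_zero_of_sum_ne_zero hne
  have near : ∀ i, α i * (c * phiMulDeriv ((x - ζ i) / c)) ≠ 0 → |x - ζ i| < c := by
    intro i hi
    by_contra! h
    refine hi ?_
    rw [phiMulDeriv_eq_zero, mul_zero, mul_zero]
    rwa [abs_div, abs_of_pos hc, one_le_div hc]
  refine ⟨j, left_ne_zero_of_mul hj, ?_⟩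
  rw [Finset.sum_eq_single j ?_ (by simp), abs_mul, abs_mul, abs_of_pos hc]
  · calc |α j| * (c * |phiMulDeriv ((x - ζ j) / c)|) ≤ |α j| * (c * 6) := by
          gcongr
          exact abs_phiMulDeriv_le _
      _ = 6 * c * |α j| := by ring
  · intro i _ hij
    by_contra hi
    have h1 := abs_lt.1 (near i hi)
    have h2 := abs_lt.1 (near j hj)
    rcases lt_or_gt_of_ne hij with h | h
    · linarith [hζ i j h]
    · linarith [hζ j i h]

/-- `G` is continuously differentiable on `ℝ` and its derivative satisfies
`1 − 6c·max_j |α_j| ≤ G'(x) ≤ 1 + 6c·max_j |α_j|` for every `x`;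
in particular `G'(x) > 0` for all `x`. -/
theorem stmt8 (k : ℕ) (ζ α : Fin k → ℝ) (hζ : StrictMono ζ) (c : ℝ) (hc : 0 < c)
    (hα : ∀ j : Fin k, α j ≠ 0 → c < 1 / (6 * |α j|))
    (hsep : ∀ (j : ℕ) (h : j + 1 < k), c < (ζ ⟨j + 1, h⟩ - ζ ⟨j, by omega⟩) / 2) :
    ContDiff ℝ 1 (Gfun k ζ α c) ∧
      ∀ x : ℝ,
        (1 - 6 * c * ⨆ j : Fin k, |α j|) ≤ deriv (Gfun k ζ α c) x ∧
        deriv (Gfun k ζ α c) x ≤ (1 + 6 * c * ⨆ j : Fin k, |α j|) ∧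
        0 < deriv (Gfun k ζ α c) x := by
  have sep : ∀ i j, i < j → 2 * c < ζ j - ζ i := by
    intro i j hij
    have hk : (i : ℕ) + 1 < k := lt_of_le_of_lt (Nat.succ_le_of_lt hij) j.2
    have h1 : c < (ζ ⟨i + 1, hk⟩ - ζ i) / 2 := hsep i hk
    have h2 : ζ ⟨i + 1, hk⟩ ≤ ζ j := hζ.monotone (Fin.le_def.2 (Nat.succ_le_of_lt hij))
    linarith
  have hderiv : deriv (Gfun k ζ α c) =
      fun x => 1 + ∑ j, α j * (c * phiMulDeriv ((x - ζ j) / c)) :=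
    funext fun x => (hasDerivAt_Gfun ζ α hc x).deriv
  refine ⟨contDiff_one_iff_deriv.2
    ⟨fun x => (hasDerivAt_Gfun ζ α hc x).differentiableAt, ?_⟩, fun x => ?_⟩
  · rw [hderiv]
    have := continuous_phiMulDeriv
    fun_prop
  rw [hderiv]
  rcases sum_phiMulDeriv_eq_zero_or_abs_le α hc sep x with h | ⟨j, hj, h⟩
  · have hsup : 0 ≤ 6 * c * ⨆ j, |α j| :=
      mul_nonneg (by positivity) (Real.iSup_nonneg fun j => abs_nonneg _)
    simp only [h]
    exact ⟨by linarith, by linarith, by norm_num⟩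
  · have hle : |α j| ≤ ⨆ j, |α j| := le_ciSup (f := fun j => |α j|) (finite_range _).bddAbove j
    have hsup : 6 * c * |α j| ≤ 6 * c * ⨆ j, |α j| := by gcongr
    have hlt : 6 * c * |α j| < 1 := by
      have := (lt_div_iff₀ (by positivity)).1 (hα j hj)
      linarith
    have hb := abs_le.1 h
    exact ⟨by linarith, by linarith, by linarith⟩
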